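/- Let k ≥ 1 and let |ψ⟩ be a unit vector in the tensor product H_E⊗H_1⊗⋯⊗H_{2k-1} of finite-dimensional complex Hilbert spaces. For a subset S of the parties {E, 1, …, 2k-1}, let ρ_S denote the reduced density matrix of |ψ⟩⟨ψ| on the factors in S (the partial trace over the complementary factors). Assume the decoupling condition: for every subset U ⊆ {1, …, 2k-1} with |U| = k-1, S(ρ_{{E}∪U}) = S(ρ_E) + S(ρ_U). Then for every party i ∈ {1, …, 2k-1}, S(ρ_E) ≤ S(ρ_{{i}}). -/

import Mathlib

open Matrix Kronecker
open scoped ComplexOrder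

noncomputable section

/-- A density matrix: positive semidefinite with trace 1. -/
def IsDensity {n : Type*} [Fintype n] (ρ : Matrix n n ℂ) : Prop :=
  ρ.PosSemidef ∧ ρ.trace = 1

/-- The outer product `|v⟩⟨v|`. -/
def outer {n : Type*} (v : n → ℂ) : Matrix n n ℂ :=
  Matrix.of fun i j => v i * (starRingEnd ℂ) (v j)

/-- Partial trace over the second tensor factor. -/
def ptrace2 {m n : Type*} [Fintype n] (M : Matrix (m × n) (m × n) ℂ) :
    Matrix m m ℂ := Matrix.of fun i i' => ∑ j, M (i, j) (i', j)

/-- Partial trace over the first tensor factor. -/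
def ptrace1 {m n : Type*} [Fintype m] (M : Matrix (m × n) (m × n) ℂ) :
    Matrix n n ℂ := Matrix.of fun j j' => ∑ i, M (i, j) (i, j')

/-- `(M, ω)` is a universal quantum masker for `d`-dimensional states:
`M` is a unitary from `ℂ^d ⊗ ℂ^s` to `ℂ^{dA} ⊗ ℂ^{dB}`, `ω` is a density matrix on `ℂ^s`,
and both marginals of `Φ(ρ) = M (ρ ⊗ ω) M†` are independent of the input density matrix `ρ`. -/
def IsMasker (d s dA dB : ℕ) (M : Matrix (Fin dA × Fin dB) (Fin d × Fin s) ℂ)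
    (ω : Matrix (Fin s) (Fin s) ℂ) : Prop :=
  Mᴴ * M = 1 ∧ M * Mᴴ = 1 ∧ IsDensity ω ∧
  ∃ (σA : Matrix (Fin dA) (Fin dA) ℂ) (σB : Matrix (Fin dB) (Fin dB) ℂ),
    IsDensity σA ∧ IsDensity σB ∧
    ∀ ρ : Matrix (Fin d) (Fin d) ℂ, IsDensity ρ →
      ptrace2 (M * (ρ ⊗ₖ ω) * Mᴴ) = σA ∧ ptrace1 (M * (ρ ⊗ₖ ω) * Mᴴ) = σB

/-- Von Neumann entropy in bits: `-∑ λ log₂ λ` over the eigenvalues. -/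
def vNEntropy {n : Type*} [Fintype n] [DecidableEq n] (ρ : Matrix n n ℂ) : ℝ :=
  if h : ρ.IsHermitian then -∑ i, h.eigenvalues i * Real.logb 2 (h.eigenvalues i)
  else 0

/-- Reduced density matrix on the subset `S` of the tensor factors (partial trace over the
complement). -/
def reduced {P : Type*} [Fintype P] [DecidableEq P] {dim : P → ℕ}
    (S : Finset P) (ρ : Matrix (∀ p, Fin (dim p)) (∀ p, Fin (dim p)) ℂ) :
    Matrix (∀ p : {p // p ∈ S}, Fin (dim p.1)) (∀ p : {p // p ∈ S}, Fin (dim p.1)) ℂ :=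
  Matrix.of fun x y => ∑ z : ∀ p : {p // p ∉ S}, Fin (dim p.1),
    ρ (fun p => if h : p ∈ S then x ⟨p, h⟩ else z ⟨p, h⟩)
      (fun p => if h : p ∈ S then y ⟨p, h⟩ else z ⟨p, h⟩)

section PartialTrace

variable {m n : Type*} [Fintype m] [Fintype n]

theorem ptrace2_posSemidef {m n : Type*} [Fintype n] {M : Matrix (m × n) (m × n) ℂ}
    (hM : M.PosSemidef) :
    (ptrace2 M).PosSemidef := by
  have : ptrace2 M = ∑ j, M.submatrix (fun i => (i, j)) (fun i => (i, j)) := by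
    ext i i'
    simp [ptrace2, Matrix.sum_apply]
  rw [this]
  exact Matrix.posSemidef_sum _ fun j _ => hM.submatrix _

theorem ptrace1_eq_ptrace2_swap {m n : Type*} [Fintype m] (M : Matrix (m × n) (m × n) ℂ) :
    ptrace1 M = ptrace2 (M.submatrix Prod.swap Prod.swap) := rfl

theorem trace_ptrace2 (M : Matrix (m × n) (m × n) ℂ) : (ptrace2 M).trace = M.trace := by
  simp [Matrix.trace, ptrace2, Fintype.sum_prod_type]

theorem trace_ptrace1 (M : Matrix (m × n) (m × n) ℂ) : (ptrace1 M).trace = M.trace := by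
  simp [Matrix.trace, ptrace1, Fintype.sum_prod_type_right]

theorem isDensity_ptrace2 {M : Matrix (m × n) (m × n) ℂ} (hM : IsDensity M) :
    IsDensity (ptrace2 M) :=
  ⟨ptrace2_posSemidef hM.1, (trace_ptrace2 M).trans hM.2⟩

theorem isDensity_ptrace1 {M : Matrix (m × n) (m × n) ℂ} (hM : IsDensity M) :
    IsDensity (ptrace1 M) :=
  ⟨ptrace2_posSemidef (hM.1.submatrix Prod.swap), (trace_ptrace1 M).trans hM.2⟩

end PartialTrace

section Entropy

variable {m n : Type*} [Fintype m] [DecidableEq m] [Fintype n] [DecidableEq n]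

/-- The entropy is a symmetric function of the roots of the characteristic polynomial. -/
theorem vNEntropy_eq_roots {ρ : Matrix n n ℂ} (h : ρ.IsHermitian) :
    vNEntropy ρ = -(ρ.charpoly.roots.map fun z : ℂ => z.re * Real.logb 2 z.re).sum := by
  rw [vNEntropy, dif_pos h, h.roots_charpoly_eq_eigenvalues, Multiset.map_map]
  simp only [Function.comp_def, Complex.coe_algebraMap]
  rfl

theorem vNEntropy_submatrix_equiv (ρ : Matrix n n ℂ) (e : m ≃ n) :
    vNEntropy (ρ.submatrix e e) = vNEntropy ρ := by
  by_cases h : ρ.IsHermitian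
  · rw [vNEntropy_eq_roots h, vNEntropy_eq_roots (h.submatrix e)]
    have : ρ.submatrix e e = Matrix.reindex e.symm e.symm ρ := rfl
    rw [this, Matrix.charpoly_reindex]
  · have h' : ¬(ρ.submatrix e e).IsHermitian := fun hc => h <| by
      simpa using hc.submatrix e.symm
    rw [vNEntropy, vNEntropy, dif_neg h, dif_neg h']

theorem vNEntropy_transpose (ρ : Matrix n n ℂ) : vNEntropy ρᵀ = vNEntropy ρ := by
  by_cases h : ρ.IsHermitian
  · rw [vNEntropy_eq_roots h, vNEntropy_eq_roots h.transpose, Matrix.charpoly_transpose]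
  · have h' : ¬ρᵀ.IsHermitian := fun hc => h <| by simpa using hc.transpose
    rw [vNEntropy, vNEntropy, dif_neg h, dif_neg h']

theorem vNEntropy_mul_conjTranspose (M : Matrix m n ℂ) :
    vNEntropy (M * Mᴴ) = vNEntropy (Mᴴ * M) := by
  rw [vNEntropy_eq_roots (Matrix.isHermitian_mul_conjTranspose_self M),
    vNEntropy_eq_roots (Matrix.isHermitian_conjTranspose_mul_self M)]
  have h := congrArg Polynomial.roots (Matrix.charpoly_mul_comm' M Mᴴ)
  have hX : ∀ k : ℕ, (Polynomial.X ^ k : Polynomial ℂ) ≠ 0 := fun k =>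
    pow_ne_zero _ Polynomial.X_ne_zero
  rw [Polynomial.roots_mul (mul_ne_zero (hX _) (Matrix.charpoly_monic _).ne_zero),
    Polynomial.roots_mul (mul_ne_zero (hX _) (Matrix.charpoly_monic _).ne_zero)] at h
  have h' := congrArg
    (fun s : Multiset ℂ => (s.map fun z : ℂ => z.re * Real.logb 2 z.re).sum) h
  simpa [Multiset.map_nsmul, Multiset.sum_nsmul] using h'

/-- Pointwise form of Gibbs' inequality. -/
theorem gibbs_term {d l q : ℝ} (hd : 0 ≤ d) (hl : 0 ≤ l) (hq : 0 ≤ q)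
    (h : q = 0 → d * l = 0) :
    d * (l - q) ≤ d * l * (Real.log l - Real.log q) := by
  rcases hl.eq_or_lt with rfl | hl
  · simpa using mul_nonneg hd hq
  rcases hq.eq_or_lt with rfl | hq
  · have : d = 0 := by simpa [hl.ne'] using h rfl
    simp [this]
  have h1 := Real.log_le_sub_one_of_pos (div_pos hq hl)
  rw [Real.log_div hq.ne' hl.ne'] at h1
  have h2 : l * (q / l) = q := by field_simp
  rw [mul_assoc]
  refine mul_le_mul_of_nonneg_left ?_ hd
  nlinarith

/-- Klein's inequality against an operator `∑ q x |x⟩⟨x|` diagonal in the basis given by the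
columns of the unitary `K`. -/
theorem klein_inequality {ρ K : Matrix n n ℂ} (hρ : ρ.PosSemidef) (hK : Kᴴ * K = 1)
    {q : n → ℝ} (hq : ∀ x, 0 ≤ q x) (hsum : ∑ x, q x ≤ ρ.trace.re)
    (hsupp : ∀ x, q x = 0 → ((Kᴴ * ρ * K) x x).re = 0) :
    ∑ x, ((Kᴴ * ρ * K) x x).re * Real.log (q x) ≤
      ∑ i, hρ.isHermitian.eigenvalues i * Real.log (hρ.isHermitian.eigenvalues i) := by
  set l := hρ.isHermitian.eigenvalues
  set U : Matrix n n ℂ := hρ.isHermitian.eigenvectorUnitary.val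
  have hUU : U * Uᴴ = 1 := Unitary.coe_mul_star_self hρ.isHermitian.eigenvectorUnitary
  have hUU' : Uᴴ * U = 1 := Unitary.coe_star_mul_self hρ.isHermitian.eigenvectorUnitary
  have hspec : ρ = U * diagonal (fun i => (l i : ℂ)) * Uᴴ := by
    conv_lhs => rw [hρ.isHermitian.spectral_theorem, Unitary.conjStarAlgAut_apply]
    rfl
  set W : Matrix n n ℂ := Kᴴ * U with hW
  have hWW : W * Wᴴ = 1 := by
    rw [hW, conjTranspose_mul, conjTranspose_conjTranspose, Matrix.mul_assoc,
      ← Matrix.mul_assoc U, hUU, Matrix.one_mul, hK]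
  have hWW' : Wᴴ * W = 1 := mul_eq_one_comm.mp hWW
  have hdiag : ∀ x, ((Kᴴ * ρ * K) x x).re = ∑ i, Complex.normSq (W x i) * l i := by
    intro x
    have : Kᴴ * ρ * K = W * diagonal (fun i => (l i : ℂ)) * Wᴴ := by
      rw [hspec, hW, conjTranspose_mul, conjTranspose_conjTranspose]
      simp only [Matrix.mul_assoc]
    rw [this, Matrix.mul_apply]
    simp only [Matrix.mul_diagonal, conjTranspose_apply, Complex.re_sum]
    refine Finset.sum_congr rfl fun i _ => ?_
    rw [mul_right_comm, Complex.star_def, Complex.mul_conj, ← Complex.ofReal_mul,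
      Complex.ofReal_re]
  have hrow : ∀ x, ∑ i, Complex.normSq (W x i) = 1 := by
    intro x
    have := congrArg Complex.re (congrFun (congrFun hWW x) x)
    simpa [Matrix.mul_apply, Complex.mul_conj, Complex.re_sum, -Complex.mul_re] using this
  have hcol : ∀ i, ∑ x, Complex.normSq (W x i) = 1 := by
    intro i
    have := congrArg Complex.re (congrFun (congrFun hWW' i) i)
    simpa [Matrix.mul_apply, ← Complex.normSq_eq_conj_mul_self, Complex.re_sum,
      -Complex.mul_re] using this
  have hl0 : ∀ i, 0 ≤ l i := hρ.eigenvalues_nonneg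
  have hterm : ∀ x i, Complex.normSq (W x i) * (l i - q x) ≤
      Complex.normSq (W x i) * l i * (Real.log (l i) - Real.log (q x)) := by
    intro x i
    refine gibbs_term (Complex.normSq_nonneg _) (hl0 i) (hq x) fun hx => ?_
    have h0 := hsupp x hx
    rw [hdiag, Finset.sum_eq_zero_iff_of_nonneg
      fun i _ => mul_nonneg (Complex.normSq_nonneg _) (hl0 i)] at h0
    exact h0 i (Finset.mem_univ i)
  have htr : ρ.trace.re = ∑ i, l i := by
    rw [hρ.isHermitian.trace_eq_sum_eigenvalues, Complex.re_sum]
    rfl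
  have hmain := Finset.sum_le_sum fun x (_ : x ∈ Finset.univ) =>
    Finset.sum_le_sum fun i (_ : i ∈ Finset.univ) => hterm x i
  simp only [mul_sub, Finset.sum_sub_distrib] at hmain
  have e1 : ∑ x, ∑ i, Complex.normSq (W x i) * l i = ∑ i, l i := by
    rw [Finset.sum_comm]
    simp only [← Finset.sum_mul, hcol, one_mul]
  have e2 : ∑ x, ∑ i, Complex.normSq (W x i) * q x = ∑ x, q x := by
    simp only [← Finset.sum_mul, hrow, one_mul]
  have e3 : ∑ x, ∑ i, Complex.normSq (W x i) * l i * Real.log (l i) =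
      ∑ i, l i * Real.log (l i) := by
    rw [Finset.sum_comm]
    simp only [mul_assoc, ← Finset.sum_mul, hcol, one_mul]
  have e4 : ∑ x, ∑ i, Complex.normSq (W x i) * l i * Real.log (q x) =
      ∑ x, ((Kᴴ * ρ * K) x x).re * Real.log (q x) := by
    simp only [hdiag, Finset.sum_mul]
  rw [e1, e2, e3, e4] at hmain
  linarith

theorem ptrace2_kronecker_conj {m n : Type*} [Fintype m] [Fintype n] [DecidableEq n]
    (M : Matrix (m × n) (m × n) ℂ) (A : Matrix m m ℂ)
    {B : Matrix n n ℂ} (hB : B * Bᴴ = 1) :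
    ptrace2 ((A ⊗ₖ B)ᴴ * M * (A ⊗ₖ B)) = Aᴴ * ptrace2 M * A := by
  have hδ : ∀ b d, ∑ j, star (B b j) * B d j = if d = b then 1 else 0 := by
    intro b d
    have := congrFun (congrFun hB d) b
    simpa [Matrix.mul_apply, Matrix.one_apply, mul_comm] using this
  ext i i'
  calc ptrace2 ((A ⊗ₖ B)ᴴ * M * (A ⊗ₖ B)) i i'
      = ∑ j, ∑ c, ∑ d, ∑ a, ∑ b, star (A a i) * M (a, b) (c, d) * A c i' *
          (star (B b j) * B d j) := by
        simp only [ptrace2, Matrix.of_apply, Matrix.mul_apply, Fintype.sum_prod_type,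
          conjTranspose_apply, kroneckerMap_apply, Finset.sum_mul, star_mul']
        refine Finset.sum_congr rfl fun j _ => Finset.sum_congr rfl fun c _ =>
          Finset.sum_congr rfl fun d _ => Finset.sum_congr rfl fun a _ =>
          Finset.sum_congr rfl fun b _ => by ring
    _ = ∑ c, ∑ d, ∑ a, ∑ b, ∑ j, star (A a i) * M (a, b) (c, d) * A c i' *
          (star (B b j) * B d j) := by
        rw [Finset.sum_comm]
        refine Finset.sum_congr rfl fun c _ => ?_
        rw [Finset.sum_comm]
        refine Finset.sum_congr rfl fun d _ => ?_
        rw [Finset.sum_comm]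
        refine Finset.sum_congr rfl fun a _ => ?_
        rw [Finset.sum_comm]
    _ = (Aᴴ * ptrace2 M * A) i i' := by
        simp only [← Finset.mul_sum, hδ, mul_ite, mul_one, mul_zero, Finset.sum_ite_eq,
          Finset.mem_univ, if_true, Matrix.mul_apply, ptrace2, Matrix.of_apply,
          conjTranspose_apply, Finset.sum_mul]
        refine Finset.sum_congr rfl fun c _ => ?_
        rw [Finset.sum_comm]
        simp only [Finset.mul_sum, Finset.sum_mul]

theorem ptrace1_kronecker_conj {m n : Type*} [Fintype m] [DecidableEq m] [Fintype n]
    (M : Matrix (m × n) (m × n) ℂ) {A : Matrix m m ℂ}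
    (B : Matrix n n ℂ) (hA : A * Aᴴ = 1) :
    ptrace1 ((A ⊗ₖ B)ᴴ * M * (A ⊗ₖ B)) = Bᴴ * ptrace1 M * B := by
  have hs : (A ⊗ₖ B).submatrix Prod.swap Prod.swap = B ⊗ₖ A := by
    ext ⟨i, j⟩ ⟨i', j'⟩
    simp [mul_comm]
  rw [ptrace1_eq_ptrace2_swap, ptrace1_eq_ptrace2_swap, ← ptrace2_kronecker_conj _ B hA, ← hs]
  congr 1
  rw [conjTranspose_submatrix]
  have hmul (X Y : Matrix (m × n) (m × n) ℂ) :
      X.submatrix Prod.swap Prod.swap * Y.submatrix Prod.swap Prod.swap =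
        (X * Y).submatrix Prod.swap Prod.swap :=
    Matrix.submatrix_mul_equiv X Y Prod.swap (Equiv.prodComm n m) Prod.swap
  rw [hmul, hmul]

theorem eigenvectorUnitary_conj_apply_self {ρ : Matrix n n ℂ} (h : ρ.IsHermitian) (i : n) :
    (((h.eigenvectorUnitary : Matrix n n ℂ)ᴴ * ρ * h.eigenvectorUnitary) i i).re =
      h.eigenvalues i := by
  have := h.conjStarAlgAut_star_eigenvectorUnitary
  rw [Unitary.conjStarAlgAut_apply] at this
  simp only [Unitary.coe_star, Matrix.star_eq_conjTranspose, conjTranspose_conjTranspose] at this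
  rw [this]
  simp

/-- Subadditivity of the von Neumann entropy. -/
theorem vNEntropy_subadditive {ρ : Matrix (m × n) (m × n) ℂ} (hρ : IsDensity ρ) :
    vNEntropy ρ ≤ vNEntropy (ptrace2 ρ) + vNEntropy (ptrace1 ρ) := by
  have hA := (isDensity_ptrace2 hρ).1
  have hB := (isDensity_ptrace1 hρ).1
  have hα := hA.eigenvalues_nonneg
  have hβ := hB.eigenvalues_nonneg
  have hαtr := hA.isHermitian.trace_eq_sum_eigenvalues
  have hβtr := hB.isHermitian.trace_eq_sum_eigenvalues
  have hαd := eigenvectorUnitary_conj_apply_self hA.isHermitian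
  have hβd := eigenvectorUnitary_conj_apply_self hB.isHermitian
  have hUA : (hA.isHermitian.eigenvectorUnitary : Matrix m m ℂ) *
    (hA.isHermitian.eigenvectorUnitary : Matrix m m ℂ)ᴴ = 1 := Unitary.coe_mul_star_self _
  have hUB : (hB.isHermitian.eigenvectorUnitary : Matrix n n ℂ) *
    (hB.isHermitian.eigenvectorUnitary : Matrix n n ℂ)ᴴ = 1 := Unitary.coe_mul_star_self _
  rw [vNEntropy, vNEntropy, vNEntropy, dif_pos hρ.1.isHermitian, dif_pos hA.isHermitian,
    dif_pos hB.isHermitian]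
  simp only [Real.logb]
  generalize hA.isHermitian.eigenvalues = α at *
  generalize hB.isHermitian.eigenvalues = β at *
  generalize (hA.isHermitian.eigenvectorUnitary : Matrix m m ℂ) = UA at *
  generalize (hB.isHermitian.eigenvectorUnitary : Matrix n n ℂ) = UB at *
  rw [(isDensity_ptrace2 hρ).2] at hαtr
  rw [(isDensity_ptrace1 hρ).2] at hβtr
  have hαs : ∑ i, α i = 1 := by
    simpa using (congrArg Complex.re hαtr).symm
  have hβs : ∑ i, β i = 1 := by
    simpa using (congrArg Complex.re hβtr).symm
  have hK : (UA ⊗ₖ UB)ᴴ * (UA ⊗ₖ UB) = 1 := by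
    rw [conjTranspose_kronecker, ← Matrix.mul_kronecker_mul, mul_eq_one_comm.mp hUA,
      mul_eq_one_comm.mp hUB, Matrix.one_kronecker_one]
  rw [← ptrace2_kronecker_conj _ _ hUB] at hαd
  rw [← ptrace1_kronecker_conj _ _ hUA] at hβd
  have hp0 : ∀ x, 0 ≤ (((UA ⊗ₖ UB)ᴴ * ρ * (UA ⊗ₖ UB)) x x).re := fun x =>
    (Complex.le_def.mp (hρ.1.conjTranspose_mul_mul_same (UA ⊗ₖ UB)).diag_nonneg).1
  have hkl := klein_inequality (q := fun x => α x.1 * β x.2) hρ.1 hK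
    (fun x => mul_nonneg (hα _) (hβ _))
    (by simp [Fintype.sum_prod_type, ← Finset.mul_sum, hαs, hβs, hρ.2])
  generalize (UA ⊗ₖ UB)ᴴ * ρ * (UA ⊗ₖ UB) = M at *
  have hαd' : ∀ i, ∑ j, (M (i, j) (i, j)).re = α i := fun i => by
    rw [← hαd, ptrace2, Matrix.of_apply, Complex.re_sum]
  have hβd' : ∀ j, ∑ i, (M (i, j) (i, j)).re = β j := fun i => by
    rw [← hβd, ptrace1, Matrix.of_apply, Complex.re_sum]
  have hα0 : ∀ i j, α i = 0 → (M (i, j) (i, j)).re = 0 := fun i j h => by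
    rw [← hαd', Finset.sum_eq_zero_iff_of_nonneg fun j _ => hp0 (i, j)] at h
    exact h j (Finset.mem_univ j)
  have hβ0 : ∀ i j, β j = 0 → (M (i, j) (i, j)).re = 0 := fun i j h => by
    rw [← hβd', Finset.sum_eq_zero_iff_of_nonneg fun i _ => hp0 (i, j)] at h
    exact h i (Finset.mem_univ i)
  have hlog : ∀ i j, (M (i, j) (i, j)).re * Real.log (α i * β j) =
      (M (i, j) (i, j)).re * Real.log (α i) + (M (i, j) (i, j)).re * Real.log (β j) := by
    intro i j
    by_cases h1 : α i = 0
    · simp [hα0 i j h1]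
    by_cases h2 : β j = 0
    · simp [hβ0 i j h2]
    rw [Real.log_mul h1 h2, mul_add]
  specialize hkl fun x hx => (mul_eq_zero.mp hx).elim (hα0 x.1 x.2) (hβ0 x.1 x.2)
  have e1 : ∑ i, ∑ j, (M (i, j) (i, j)).re * Real.log (α i) = ∑ i, α i * Real.log (α i) := by
    simp only [← Finset.sum_mul, hαd']
  have e2 : ∑ i, ∑ j, (M (i, j) (i, j)).re * Real.log (β j) = ∑ j, β j * Real.log (β j) := by
    rw [Finset.sum_comm]
    simp only [← Finset.sum_mul, hβd']
  simp only [Fintype.sum_prod_type, hlog, Finset.sum_add_distrib, e1, e2] at hkl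
  simp only [Fintype.sum_prod_type, ← mul_div_assoc, ← Finset.sum_div]
  rw [← neg_add, ← add_div]
  gcongr

end Entropy

section Reduced

variable {P : Type*} [Fintype P] [DecidableEq P] {dim : P → ℕ}

/-- Split a dependent function on a disjoint union of two subtypes. -/
def piSplit {P : Type*} {F : P → Type*} {p q r : P → Prop} [DecidablePred p]
    (h : ∀ x, r x ↔ p x ∨ q x) (hd : ∀ x, p x → ¬q x) :
    (∀ x : {x // r x}, F x) ≃ (∀ x : {x // p x}, F x) × (∀ x : {x // q x}, F x) where
  toFun f := (fun x => f ⟨x, (h x).2 (Or.inl x.2)⟩, fun x => f ⟨x, (h x).2 (Or.inr x.2)⟩)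
  invFun g x := if hx : p x then g.1 ⟨x, hx⟩ else g.2 ⟨x, ((h x).1 x.2).resolve_left hx⟩
  left_inv f := by
    funext x
    by_cases hx : p x <;> simp [hx]
  right_inv g := by
    refine Prod.ext (funext fun x => ?_) (funext fun x => ?_)
    · simp [x.2]
    · have hx : ¬p x := fun hx => hd _ hx x.2
      simp [hx]

theorem reduced_eq_ptrace2 (S : Finset P) (ρ : Matrix (∀ p, Fin (dim p)) (∀ p, Fin (dim p)) ℂ) :
    reduced S ρ = ptrace2 (ρ.submatrix (Equiv.piEquivPiSubtypeProd (· ∈ S) fun p => Fin (dim p)).symm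
      (Equiv.piEquivPiSubtypeProd (· ∈ S) fun p => Fin (dim p)).symm) := rfl

theorem IsDensity.submatrix_equiv {m n : Type*} [Fintype m] [Fintype n] {ρ : Matrix n n ℂ}
    (h : IsDensity ρ) (e : m ≃ n) : IsDensity (ρ.submatrix e e) :=
  ⟨h.1.submatrix e, (e.sum_comp fun i => ρ i i).trans h.2⟩

theorem IsDensity.reduced {ρ : Matrix (∀ p, Fin (dim p)) (∀ p, Fin (dim p)) ℂ}
    (h : IsDensity ρ) (S : Finset P) : IsDensity (reduced S ρ) := by
  rw [reduced_eq_ptrace2]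
  exact isDensity_ptrace2 (h.submatrix_equiv _)

theorem vNEntropy_reduced_union_le {ρ : Matrix (∀ p, Fin (dim p)) (∀ p, Fin (dim p)) ℂ}
    (h : IsDensity ρ) {S T : Finset P} (hST : Disjoint S T) :
    vNEntropy (reduced (S ∪ T) ρ) ≤ vNEntropy (reduced S ρ) + vNEntropy (reduced T ρ) := by
  have hd : ∀ x, x ∈ S → x ∉ T := fun _ h => Finset.disjoint_left.mp hST h
  let e := piSplit (F := fun p => Fin (dim p)) (fun x => Finset.mem_union (s := S) (t := T)) hd
  have h1 : ptrace2 ((reduced (S ∪ T) ρ).submatrix e.symm e.symm) = reduced S ρ := by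
    let f := piSplit (F := fun p => Fin (dim p)) (p := (· ∈ T)) (q := (· ∉ S ∪ T))
      (r := (· ∉ S)) (by grind) (by grind)
    ext x y
    simp only [ptrace2, reduced, Matrix.of_apply, Matrix.submatrix_apply]
    rw [← Fintype.sum_prod_type', ← f.sum_comp]
    refine Finset.sum_congr rfl fun z _ => ?_
    congr 1 <;>
    · funext p
      by_cases hS : p ∈ S <;> by_cases hT : p ∈ T <;> simp [e, f, piSplit, hS, hT]
  have h2 : ptrace1 ((reduced (S ∪ T) ρ).submatrix e.symm e.symm) = reduced T ρ := by
    let f := piSplit (F := fun p => Fin (dim p)) (p := (· ∈ S)) (q := (· ∉ S ∪ T))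
      (r := (· ∉ T)) (by grind) (by grind)
    ext x y
    simp only [ptrace1, reduced, Matrix.of_apply, Matrix.submatrix_apply]
    rw [← Fintype.sum_prod_type', ← f.sum_comp]
    refine Finset.sum_congr rfl fun z _ => ?_
    congr 1 <;>
    · funext p
      by_cases hS : p ∈ S
      · have hT := hd p hS
        simp [e, f, piSplit, hS, hT]
      · by_cases hT : p ∈ T <;> simp [e, f, piSplit, hS, hT]
  rw [← h1, ← h2, ← vNEntropy_submatrix_equiv (reduced (S ∪ T) ρ) e.symm]
  exact vNEntropy_subadditive ((h.reduced _).submatrix_equiv _)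

/-- Complementary reductions of a pure state have equal entropy. -/
theorem vNEntropy_reduced_compl (S : Finset P) (ψ : (∀ p, Fin (dim p)) → ℂ) :
    vNEntropy (reduced Sᶜ (outer ψ)) = vNEntropy (reduced S (outer ψ)) := by
  let M : Matrix (∀ p : {p // p ∈ S}, Fin (dim p)) (∀ p : {p // p ∉ S}, Fin (dim p)) ℂ :=
    Matrix.of fun x z => ψ ((Equiv.piEquivPiSubtypeProd (· ∈ S) fun p => Fin (dim p)).symm (x, z))
  have h1 : reduced S (outer ψ) = M * Mᴴ := rfl
  let e : (∀ p : {p // p ∈ Sᶜ}, Fin (dim p)) ≃ (∀ p : {p // p ∉ S}, Fin (dim p)) :=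
    ⟨fun x p => x ⟨p.1, Finset.mem_compl.2 p.2⟩, fun x p => x ⟨p.1, Finset.mem_compl.1 p.2⟩,
      fun _ => rfl, fun _ => rfl⟩
  let f : (∀ p : {p // p ∉ Sᶜ}, Fin (dim p)) ≃ (∀ p : {p // p ∈ S}, Fin (dim p)) :=
    ⟨fun x p => x ⟨p.1, fun h => Finset.mem_compl.1 h p.2⟩,
      fun x p => x ⟨p.1, by simpa using p.2⟩, fun _ => rfl, fun _ => rfl⟩
  have h2 : reduced Sᶜ (outer ψ) = ((Mᴴ * M)ᵀ).submatrix e e := by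
    ext x y
    simp only [reduced, outer, M, Matrix.of_apply, Matrix.submatrix_apply, Matrix.transpose_apply,
      Matrix.mul_apply, Matrix.conjTranspose_apply]
    rw [← f.sum_comp]
    refine Finset.sum_congr rfl fun z _ => ?_
    rw [mul_comm]
    refine congrArg₂ (fun u v => star (ψ u) * ψ v) ?_ ?_ <;>
    · funext p
      by_cases hS : p ∈ S <;> simp [e, f, Equiv.piEquivPiSubtypeProd, hS]
  rw [h1, h2, vNEntropy_submatrix_equiv, vNEntropy_transpose, vNEntropy_mul_conjTranspose]

theorem isDensity_outer {n : Type*} [Fintype n] {ψ : n → ℂ} (hψ : ∑ x, ‖ψ x‖ ^ 2 = 1) :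
    IsDensity (outer ψ) := by
  refine ⟨Matrix.posSemidef_vecMulVec_self_star ψ, ?_⟩
  simp only [Matrix.trace, Matrix.diag, outer, Matrix.of_apply, Complex.mul_conj,
    Complex.normSq_eq_norm_sq]
  exact_mod_cast hψ

end Reduced

/-- decoupling implies the entropy of any single party dominates the entropy
of the reference `E`. The parties are `none` (= `E`) and `some i` for `i : Fin (2k-1)`. -/
theorem decoupling_entropy_bound
    (k : ℕ) (hk : 1 ≤ k)
    (dim : Option (Fin (2 * k - 1)) → ℕ) (hdim : ∀ p, 0 < dim p)
    (ψ : (∀ p, Fin (dim p)) → ℂ)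
    (hψ : ∑ x, ‖ψ x‖ ^ 2 = 1)
    (hdec : ∀ U : Finset (Fin (2 * k - 1)), U.card = k - 1 →
      vNEntropy (reduced (insert none (U.image some)) (outer ψ)) =
        vNEntropy (reduced ({none} : Finset (Option (Fin (2 * k - 1)))) (outer ψ)) +
          vNEntropy (reduced (U.image some) (outer ψ)))
    (i : Fin (2 * k - 1)) :
    vNEntropy (reduced ({none} : Finset (Option (Fin (2 * k - 1)))) (outer ψ)) ≤
      vNEntropy (reduced ({some i} : Finset (Option (Fin (2 * k - 1)))) (outer ψ)) := by
  obtain ⟨U, hUs, hUc⟩ := Finset.exists_subset_card_eq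
    (s := Finset.univ.erase i) (n := k - 1) (by simp; omega)
  have hVc : (Finset.univ.erase i \ U).card = k - 1 := by
    rw [Finset.card_sdiff_of_subset hUs, hUc]
    simp
    omega
  set V := Finset.univ.erase i \ U with hV
  have hρ := isDensity_outer hψ
  have key : ∀ A B : Finset (Fin (2 * k - 1)), A.card = k - 1 → i ∉ B →
      (∀ x, x ∉ A ↔ x ∈ B ∨ x = i) →
      vNEntropy (reduced ({none} : Finset (Option (Fin (2 * k - 1)))) (outer ψ)) +
        vNEntropy (reduced (A.image some) (outer ψ)) ≤
      vNEntropy (reduced (B.image some) (outer ψ)) +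
        vNEntropy (reduced ({some i} : Finset (Option (Fin (2 * k - 1)))) (outer ψ)) := by
    intro A B hA hi hAB
    have hc : (insert none (A.image some))ᶜ = B.image some ∪ {some i} := by
      ext (_ | x) <;> simp [hAB, or_comm]
    rw [← hdec A hA, ← vNEntropy_reduced_compl, hc]
    exact vNEntropy_reduced_union_le hρ (by simpa using hi)
  have h1 := key U V hUc (by simp [hV]) (by grind)
  have h2 := key V U hVc (by grind) (by grind)
  linarith

end
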